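/- arXiv:2501.00873 — 4 statements merged into one kernel-verified Lean document; each statement's English description precedes it below -/
import Mathlib

section
/- (Tweedie's formula, isotropic Gaussian noise.) Let σ > 0 and let π be a probability measure on ℝⁿ. Define the marginal p(z) = ∫ φ_{μ,σ²}(z) dπ(μ). Then: (i) p(z) > 0 for every z ∈ ℝⁿ; (ii) p is differentiable on ℝⁿ; (iii) for every z the map μ ↦ φ_{μ,σ²}(z) • μ is Bochner integrable with respect to π; and (iv) the posterior mean m(z) := (1/p(z)) • ∫ φ_{μ,σ²}(z) • μ dπ(μ) satisfies m(z) = z + σ² • ∇ log p(z). -/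
open MeasureTheory

lemma tw_bound (s t : ℝ) (hs : 0 < s) : Real.exp (-t ^ 2 / (2 * s)) * t ≤ 1 + s := by
  have h1 := Real.add_one_le_exp (t ^ 2 / (2 * s))
  have h2 : t ≤ (1 + s) * Real.exp (t ^ 2 / (2 * s)) := by
    have h3 : t ≤ t ^ 2 / (2 * s) + s / 2 := by
      rw [div_add_div _ _ (by positivity) (by positivity), le_div_iff₀ (by positivity)]
      nlinarith [sq_nonneg (t - s)]
    have h4 : 0 ≤ t ^ 2 / (2 * s) := by positivity
    nlinarith
  rw [neg_div, Real.exp_neg, inv_mul_le_iff₀ (Real.exp_pos _)]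
  linarith

lemma tw_grad {E : Type*} [NormedAddCommGroup E] [InnerProductSpace ℝ E]
    (c s : ℝ) (hs : 0 < s) (m z : E) :
    HasFDerivAt (fun z : E => c * Real.exp (-‖z - m‖ ^ 2 / (2 * s)))
      (innerSL ℝ ((c * Real.exp (-‖z - m‖ ^ 2 / (2 * s))) • (s⁻¹ • (m - z)))) z := by
  have h1 : HasFDerivAt (fun z : E => ‖z - m‖ ^ 2) _ z :=
    ((hasFDerivAt_id z).sub_const m).norm_sq
  have h2 := (((h1.neg).mul_const ((2 * s)⁻¹)).exp).const_mul c
  simp only [div_eq_mul_inv]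
  refine h2.congr_fderiv ?_
  ext v
  simp [inner_smul_left, inner_sub_left]
  field_simp
  ring

/-- Tweedie's formula for isotropic Gaussian noise. -/
theorem tweedie_formula {n : ℕ} (σ : ℝ) (hσ : 0 < σ)
    (π : Measure (EuclideanSpace ℝ (Fin n))) [IsProbabilityMeasure π] :
    let φ : EuclideanSpace ℝ (Fin n) → EuclideanSpace ℝ (Fin n) → ℝ := fun μ z =>
      (2 * Real.pi * σ ^ 2) ^ (-(n : ℝ) / 2) * Real.exp (-‖z - μ‖ ^ 2 / (2 * σ ^ 2))
    let p : EuclideanSpace ℝ (Fin n) → ℝ := fun z => ∫ μ, φ μ z ∂π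
    (∀ z, 0 < p z) ∧
    Differentiable ℝ p ∧
    (∀ z, Integrable (fun μ => φ μ z • μ) π) ∧
    (∀ z : EuclideanSpace ℝ (Fin n),
      (1 / p z) • (∫ μ, φ μ z • μ ∂π)
        = z + (σ ^ 2) • gradient (fun z' => Real.log (p z')) z) := by
  intro φ p
  have hs : 0 < σ ^ 2 := by positivity
  have hc : 0 < (2 * Real.pi * σ ^ 2) ^ (-(n : ℝ) / 2) := by positivity
  set c : ℝ := (2 * Real.pi * σ ^ 2) ^ (-(n : ℝ) / 2) with hcdef
  set s : ℝ := σ ^ 2 with hsdef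
  have hφpos : ∀ m z, 0 < φ m z := fun m z => mul_pos hc (Real.exp_pos _)
  have hφc : ∀ z, Continuous (fun m => φ m z) := fun z => by
    show Continuous (fun m => c * Real.exp (-‖z - m‖ ^ 2 / (2 * s)))
    fun_prop
  have hφle : ∀ m z, φ m z ≤ c := fun m z => by
    have : Real.exp (-‖z - m‖ ^ 2 / (2 * s)) ≤ 1 := by
      rw [Real.exp_le_one_iff, neg_div]
      have : 0 ≤ ‖z - m‖ ^ 2 / (2 * s) := by positivity
      linarith
    exact mul_le_of_le_one_right hc.le this
  have hφint : ∀ z, Integrable (fun m => φ m z) π := fun z =>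
    Integrable.of_bound (hφc z).aestronglyMeasurable c
      (Filter.Eventually.of_forall fun m => by
        rw [Real.norm_of_nonneg (hφpos m z).le]; exact hφle m z)
  have hb : ∀ m z, ‖φ m z • (m - z)‖ ≤ c * (1 + s) := fun m z => by
    rw [norm_smul, Real.norm_of_nonneg (hφpos m z).le, norm_sub_rev]
    show c * Real.exp (-‖z - m‖ ^ 2 / (2 * s)) * ‖z - m‖ ≤ _
    rw [mul_assoc]
    exact mul_le_mul_of_nonneg_left (tw_bound s _ hs) hc.le
  have hdint : ∀ z, Integrable (fun m => φ m z • (m - z)) π := fun z =>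
    Integrable.of_bound ((hφc z).smul (by fun_prop)).aestronglyMeasurable (c * (1 + s))
      (Filter.Eventually.of_forall fun m => hb m z)
  have hint : ∀ z, Integrable (fun m => φ m z • m) π := fun z => by
    have := (hdint z).add ((hφint z).smul_const z)
    refine this.congr (Filter.Eventually.of_forall fun m => ?_)
    simp [smul_sub]
  have hpos : ∀ z, 0 < p z := fun z => by
    show 0 < ∫ m, φ m z ∂π
    rw [integral_pos_iff_support_of_nonneg (fun m => (hφpos m z).le) (hφint z)]
    have : Function.support (fun m => φ m z) = Set.univ := by
      ext m; simp [(hφpos m z).ne']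
    rw [this]; simp
  have hder : ∀ z, HasFDerivAt p
      (∫ m, innerSL ℝ (φ m z • (s⁻¹ • (m - z))) ∂π) z := fun z => by
    refine hasFDerivAt_integral_of_dominated_of_fderiv_le (𝕜 := ℝ) (s := Set.univ)
      (F := fun z m => φ m z)
      (F' := fun z m => innerSL ℝ (φ m z • (s⁻¹ • (m - z))))
      (bound := fun _ => s⁻¹ * (c * (1 + s))) Filter.univ_mem
      (Filter.Eventually.of_forall fun z => (hφc z).aestronglyMeasurable) (hφint z)
      ?_ ?_ (integrable_const _) ?_
    · exact ((innerSL ℝ).continuous.comp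
        ((hφc z).smul (by fun_prop))).aestronglyMeasurable
    · refine Filter.Eventually.of_forall fun m x _ => ?_
      rw [innerSL_apply_norm, smul_comm, norm_smul, Real.norm_of_nonneg (by positivity)]
      exact mul_le_mul_of_nonneg_left (hb m x) (by positivity)
    · exact Filter.Eventually.of_forall fun m x _ => tw_grad c s hs m x
  refine ⟨hpos, fun z => (hder z).differentiableAt, hint, fun z => ?_⟩
  have hgi : Integrable (fun m => φ m z • (s⁻¹ • (m - z))) π := by
    simp_rw [smul_comm _ s⁻¹]
    exact (hdint z).smul s⁻¹
  have hg : HasGradientAt (fun z' => Real.log (p z'))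
      ((p z)⁻¹ • (s⁻¹ • ((∫ m, φ m z • m ∂π) - p z • z))) z := by
    rw [hasGradientAt_iff_hasFDerivAt]
    refine ((hder z).log (hpos z).ne').congr_fderiv ?_
    have h1 : (∫ m, innerSL ℝ (φ m z • (s⁻¹ • (m - z))) ∂π)
        = innerSL ℝ (∫ m, φ m z • (s⁻¹ • (m - z)) ∂π) :=
      (innerSL ℝ).integral_comp_comm hgi
    have h2 : (∫ m, φ m z • (s⁻¹ • (m - z)) ∂π)
        = s⁻¹ • ((∫ m, φ m z • m ∂π) - p z • z) := by
      simp_rw [smul_comm _ s⁻¹]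
      rw [integral_smul]
      simp_rw [smul_sub]
      rw [integral_sub (hint z) ((hφint z).smul_const z), integral_smul_const, smul_sub]
    rw [h1, h2]
    ext v
    simp [inner_smul_left]
  rw [hg.gradient, smul_comm s, smul_inv_smul₀ hs.ne', smul_sub, inv_smul_smul₀ (hpos z).ne',
    one_div]
  abel
end

section
/- Let σ > 0 and let π be a probability measure on ℝⁿ. Define p(z) = ∫ φ_{μ,σ²}(z) dπ(μ). Then for every z ∈ ℝⁿ the map μ ↦ φ_{μ,σ²}(z) • ((μ − z)/σ²) is Bochner integrable with respect to π, p is differentiable at every z, and its gradient is obtained by differentiating under the integral sign: ∇p(z) = ∫ φ_{μ,σ²}(z) • ((μ − z)/σ²) dπ(μ). -/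
open MeasureTheory

/-- Differentiation under the integral sign for a Gaussian mixture marginal. -/
theorem grad_gaussian_mixture {n : ℕ} (σ : ℝ) (hσ : 0 < σ)
    (π : Measure (EuclideanSpace ℝ (Fin n))) [IsProbabilityMeasure π] :
    let φ : EuclideanSpace ℝ (Fin n) → EuclideanSpace ℝ (Fin n) → ℝ := fun μ z =>
      (2 * Real.pi * σ ^ 2) ^ (-(n : ℝ) / 2) * Real.exp (-‖z - μ‖ ^ 2 / (2 * σ ^ 2))
    let p : EuclideanSpace ℝ (Fin n) → ℝ := fun z => ∫ μ, φ μ z ∂π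
    (∀ z : EuclideanSpace ℝ (Fin n),
      Integrable (fun μ => φ μ z • ((σ ^ 2)⁻¹ • (μ - z))) π) ∧
    Differentiable ℝ p ∧
    (∀ z : EuclideanSpace ℝ (Fin n),
      gradient p z = ∫ μ, φ μ z • ((σ ^ 2)⁻¹ • (μ - z)) ∂π) := by
  intro φ p
  set C : ℝ := (2 * Real.pi * σ ^ 2) ^ (-(n : ℝ) / 2) with hC
  have hC0 : 0 ≤ C := by positivity
  have hs : 0 < σ ^ 2 := by positivity
  have key : ∀ r : ℝ, Real.exp (-r ^ 2 / (2 * σ ^ 2)) * r ≤ 1 + σ ^ 2 / 2 := by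
    intro r
    have h1 : -r ^ 2 / (2 * σ ^ 2) = -(r ^ 2 / (2 * σ ^ 2)) := by ring
    have hq : 0 ≤ r ^ 2 / (2 * σ ^ 2) := by positivity
    have h2 := Real.add_one_le_exp (r ^ 2 / (2 * σ ^ 2))
    have h3 : r ≤ σ ^ 2 / 2 + r ^ 2 / (2 * σ ^ 2) := by
      have : σ ^ 2 / 2 + r ^ 2 / (2 * σ ^ 2) - r = (r - σ ^ 2) ^ 2 / (2 * σ ^ 2) := by
        field_simp
        ring
      have h4 : 0 ≤ (r - σ ^ 2) ^ 2 / (2 * σ ^ 2) := by positivity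
      linarith
    rw [h1, Real.exp_neg, inv_mul_le_iff₀ (Real.exp_pos _)]
    nlinarith
  have hbound : ∀ z μ, ‖φ μ z • ((σ ^ 2)⁻¹ • (μ - z))‖ ≤ C * ((σ ^ 2)⁻¹ * (1 + σ ^ 2 / 2)) := by
    intro z μ
    have h := key ‖z - μ‖
    rw [norm_smul, norm_smul, norm_sub_rev μ z, Real.norm_of_nonneg (by positivity : 0 ≤ φ μ z),
      Real.norm_of_nonneg (by positivity : 0 ≤ (σ ^ 2)⁻¹)]
    calc φ μ z * ((σ ^ 2)⁻¹ * ‖z - μ‖)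
        = C * ((σ ^ 2)⁻¹ * (Real.exp (-‖z - μ‖ ^ 2 / (2 * σ ^ 2)) * ‖z - μ‖)) := by
          simp only [φ]; ring
      _ ≤ _ := by gcongr
  have hφc : ∀ z, Continuous (fun μ => φ μ z) := by
    intro z
    simp only [φ]
    fun_prop
  have hGc : ∀ z, Continuous (fun μ => φ μ z • ((σ ^ 2)⁻¹ • (μ - z))) := by
    intro z
    have := hφc z
    fun_prop
  have hint : ∀ z, Integrable (fun μ => φ μ z • ((σ ^ 2)⁻¹ • (μ - z))) π := fun z =>
    Integrable.of_bound (hGc z).aestronglyMeasurable _ (Filter.Eventually.of_forall (hbound z))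
  have hφint : ∀ z, Integrable (fun μ => φ μ z) π := fun z => by
    refine Integrable.of_bound (hφc z).aestronglyMeasurable C (Filter.Eventually.of_forall ?_)
    intro μ
    rw [Real.norm_of_nonneg (by positivity : 0 ≤ φ μ z)]
    refine mul_le_of_le_one_right hC0 (Real.exp_le_one_iff.2 ?_)
    rw [neg_div]
    have : 0 ≤ ‖z - μ‖ ^ 2 / (2 * σ ^ 2) := by positivity
    linarith
  have hdiff : ∀ z μ, HasFDerivAt (fun z => φ μ z)
      (innerSL ℝ (φ μ z • ((σ ^ 2)⁻¹ • (μ - z)))) z := by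
    intro z μ
    have h0 : HasFDerivAt (fun z : EuclideanSpace ℝ (Fin n) => z - μ)
      (ContinuousLinearMap.id ℝ _) z := (hasFDerivAt_id z).sub_const μ
    have h1 := ((h0.norm_sq.const_mul (-(2 * σ ^ 2)⁻¹)).exp).const_mul C
    refine (h1.congr_of_eventuallyEq (Filter.Eventually.of_forall ?_)).congr_fderiv ?_
    · intro y
      simp only [φ]
      congr 2
      ring
    · ext v
      have e : -‖z - μ‖ ^ 2 / (2 * σ ^ 2) = -(2 * σ ^ 2)⁻¹ * ‖z - μ‖ ^ 2 := by ring
      simp only [φ, e, ← neg_sub z μ, ← hC]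
      simp [-neg_sub]
      field_simp
  have hmain : ∀ z, HasGradientAt p (∫ μ, φ μ z • ((σ ^ 2)⁻¹ • (μ - z)) ∂π) z := by
    intro z
    have hmeas : Continuous (fun μ => innerSL ℝ (φ μ z • ((σ ^ 2)⁻¹ • (μ - z)))) :=
      (innerSL ℝ).continuous.comp (hGc z)
    have hb : ∀ x μ, ‖innerSL ℝ (φ μ x • ((σ ^ 2)⁻¹ • (μ - x)))‖
        ≤ C * ((σ ^ 2)⁻¹ * (1 + σ ^ 2 / 2)) := fun x μ => by
      rw [innerSL_apply_norm]; exact hbound x μ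
    have h := hasFDerivAt_integral_of_dominated_of_fderiv_le (𝕜 := ℝ) (μ := π)
      (F := fun z μ => φ μ z) (F' := fun z μ => innerSL ℝ (φ μ z • ((σ ^ 2)⁻¹ • (μ - z))))
      (x₀ := z) (s := Set.univ) (bound := fun _ => C * ((σ ^ 2)⁻¹ * (1 + σ ^ 2 / 2)))
      Filter.univ_mem
      (Filter.Eventually.of_forall fun x => (hφc x).aestronglyMeasurable) (hφint z)
      hmeas.aestronglyMeasurable
      (Filter.Eventually.of_forall fun μ x _ => hb x μ) (integrable_const _)
      (Filter.Eventually.of_forall fun μ x _ => hdiff x μ)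
    rw [hasGradientAt_iff_hasFDerivAt]
    refine h.congr_fderiv ?_
    ext1 v
    have hI : Integrable (fun μ => innerSL ℝ (φ μ z • ((σ ^ 2)⁻¹ • (μ - z)))) π :=
      Integrable.of_bound hmeas.aestronglyMeasurable _ (Filter.Eventually.of_forall (hb z))
    rw [ContinuousLinearMap.integral_apply hI, InnerProductSpace.toDual_apply_apply,
      real_inner_comm, ← integral_inner (hint z)]
    refine integral_congr_ae (Filter.Eventually.of_forall fun μ => ?_)
    simp only [innerSL_apply_apply]
    exact real_inner_comm _ _
  exact ⟨hint, fun z => (hmain z).differentiableAt, fun z => (hmain z).gradient⟩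
end

section
/- Let ᾱ ∈ (0,1) and let π be a probability measure on ℝⁿ (the law of the clean data x₀). Define the diffused marginal density p(z) = ∫ φ_{√ᾱ·x, 1−ᾱ}(z) dπ(x) and the posterior-mean noise ε̄(z) = (1/p(z)) • ∫ φ_{√ᾱ·x, 1−ᾱ}(z) • ((z − √ᾱ·x)/√(1−ᾱ)) dπ(x). Then p(z) > 0 for all z, p is differentiable, all integrals above are well-defined (Bochner integrable integrands), and the score of the diffused marginal satisfies ∇ log p(z) = − (1/√(1−ᾱ)) • ε̄(z). -/
open MeasureTheory

theorem aux_bound {v r : ℝ} (hv : 0 < v) : r * Real.exp (-r ^ 2 / (2 * v)) ≤ v + 1 := by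
  have h1 : 1 + r ^ 2 / (2 * v) ≤ Real.exp (r ^ 2 / (2 * v)) := by
    have := Real.add_one_le_exp (r ^ 2 / (2 * v)); linarith
  have h2 : r ≤ (v + 1) * (1 + r ^ 2 / (2 * v)) := by
    have : (v + 1) * (1 + r ^ 2 / (2 * v)) = v + 1 + r ^ 2 / 2 + r ^ 2 / (2 * v) := by
      field_simp
      ring
    have h3 : 0 ≤ r ^ 2 / (2 * v) := by positivity
    nlinarith [sq_nonneg (r - 1)]
  rw [neg_div, Real.exp_neg, ← div_eq_mul_inv, div_le_iff₀ (Real.exp_pos _)]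
  exact h2.trans (by gcongr)

theorem aux_deriv {E : Type*} [NormedAddCommGroup E] [InnerProductSpace ℝ E]
    (c v : ℝ) (hv : 0 < v) (y z : E) :
    HasFDerivAt (fun z => c * Real.exp (-‖z - y‖ ^ 2 / (2 * v)))
      (innerSL ℝ ((-v⁻¹ * (c * Real.exp (-‖z - y‖ ^ 2 / (2 * v)))) • (z - y))) z := by
  have h := (((((hasFDerivAt_id z).sub_const y).norm_sq).neg.mul_const (2 * v)⁻¹).exp).const_mul c
  simp only [id, ← div_eq_mul_inv] at h
  refine h.congr_fderiv ?_
  ext w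
  simp
  field_simp

theorem aux_main {E : Type*} [NormedAddCommGroup E] [InnerProductSpace ℝ E]
    [FiniteDimensional ℝ E] [MeasurableSpace E] [BorelSpace E]
    (c v s : ℝ) (hv : 0 < v) (hc : 0 < c) (π : Measure E) [IsProbabilityMeasure π] (z : E) :
    Integrable (fun x => c * Real.exp (-‖z - s • x‖ ^ 2 / (2 * v))) π ∧
    Integrable (fun x => (c * Real.exp (-‖z - s • x‖ ^ 2 / (2 * v))) • (z - s • x)) π ∧
    0 < ∫ x, c * Real.exp (-‖z - s • x‖ ^ 2 / (2 * v)) ∂π ∧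
    HasGradientAt (fun z => ∫ x, c * Real.exp (-‖z - s • x‖ ^ 2 / (2 * v)) ∂π)
      ((-v⁻¹) • ∫ x, (c * Real.exp (-‖z - s • x‖ ^ 2 / (2 * v))) • (z - s • x) ∂π) z := by
  have := FiniteDimensional.proper ℝ E
  have hcont : ∀ z : E, Continuous (fun x => c * Real.exp (-‖z - s • x‖ ^ 2 / (2 * v))) := by
    intro z; fun_prop
  have hI1 : Integrable (fun x => c * Real.exp (-‖z - s • x‖ ^ 2 / (2 * v))) π := by
    refine Integrable.of_bound (hcont z).aestronglyMeasurable c (Filter.Eventually.of_forall ?_)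
    intro x
    rw [Real.norm_of_nonneg (by positivity)]
    refine mul_le_of_le_one_right hc.le (Real.exp_le_one_iff.2 ?_)
    rw [neg_div]
    have : 0 ≤ ‖z - s • x‖ ^ 2 / (2 * v) := by positivity
    linarith
  have hb : ∀ z x : E, ‖(c * Real.exp (-‖z - s • x‖ ^ 2 / (2 * v))) • (z - s • x)‖
      ≤ c * (v + 1) := by
    intro z x
    rw [norm_smul, Real.norm_of_nonneg (by positivity), mul_assoc, mul_comm (Real.exp _)]
    exact mul_le_mul_of_nonneg_left (aux_bound hv) hc.le
  have hI2 : Integrable (fun x => (c * Real.exp (-‖z - s • x‖ ^ 2 / (2 * v))) • (z - s • x)) π :=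
    Integrable.of_bound ((hcont z).smul (by fun_prop)).aestronglyMeasurable _
      (Filter.Eventually.of_forall (hb z))
  have hcF : Continuous (fun x => innerSL ℝ
      ((-v⁻¹ * (c * Real.exp (-‖z - s • x‖ ^ 2 / (2 * v)))) • (z - s • x))) :=
    (innerSL ℝ).continuous.comp ((continuous_const.mul (hcont z)).smul (by fun_prop))
  have hbF : ∀ z x : E, ‖innerSL ℝ
      ((-v⁻¹ * (c * Real.exp (-‖z - s • x‖ ^ 2 / (2 * v)))) • (z - s • x))‖
      ≤ v⁻¹ * (c * (v + 1)) := by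
    intro z x
    rw [innerSL_apply_norm, mul_smul, norm_smul, norm_neg, Real.norm_of_nonneg (by positivity)]
    exact mul_le_mul_of_nonneg_left (hb z x) (by positivity)
  refine ⟨hI1, hI2, ?_, ?_⟩
  · rw [integral_pos_iff_support_of_nonneg (fun x => by positivity) hI1]
    have : Function.support (fun x => c * Real.exp (-‖z - s • x‖ ^ 2 / (2 * v))) = Set.univ := by
      ext x
      simp [hc.ne', Real.exp_ne_zero]
    rw [this]
    simp
  · rw [hasGradientAt_iff_hasFDerivAt]
    have h := hasFDerivAt_integral_of_dominated_of_fderiv_le (𝕜 := ℝ) (μ := π) (x₀ := z)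
      (s := Set.univ) (bound := fun _ => v⁻¹ * (c * (v + 1)))
      (F := fun z x => c * Real.exp (-‖z - s • x‖ ^ 2 / (2 * v)))
      (F' := fun z x => innerSL ℝ
        ((-v⁻¹ * (c * Real.exp (-‖z - s • x‖ ^ 2 / (2 * v)))) • (z - s • x)))
      Filter.univ_mem (Filter.Eventually.of_forall fun z => (hcont z).aestronglyMeasurable)
      hI1 hcF.aestronglyMeasurable
      (Filter.Eventually.of_forall fun x z _ => hbF z x) (integrable_const _)
      (Filter.Eventually.of_forall fun x z _ => aux_deriv c v hv (s • x) z)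
    refine h.congr_fderiv ?_
    ext w
    rw [ContinuousLinearMap.integral_apply]
    · simp only [innerSL_apply_apply, InnerProductSpace.toDual_apply_apply]
      rw [← integral_smul, real_inner_comm, ← integral_inner]
      · refine integral_congr_ae (Filter.Eventually.of_forall fun x => ?_)
        simp only [mul_smul]
        rw [real_inner_comm]
      · exact hI2.smul _
    · exact Integrable.of_bound hcF.aestronglyMeasurable _ (Filter.Eventually.of_forall (hbF z))

/-- The score of the diffused marginal equals `-(1/√(1-ᾱ))` times the
posterior-mean noise. -/
theorem score_eq_neg_posterior_mean_noise {n : ℕ} (a : ℝ) (ha0 : 0 < a) (ha1 : a < 1)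
    (π : Measure (EuclideanSpace ℝ (Fin n))) [IsProbabilityMeasure π] :
    let φ : EuclideanSpace ℝ (Fin n) → EuclideanSpace ℝ (Fin n) → ℝ := fun x z =>
      (2 * Real.pi * (1 - a)) ^ (-(n : ℝ) / 2) *
        Real.exp (-‖z - Real.sqrt a • x‖ ^ 2 / (2 * (1 - a)))
    let p : EuclideanSpace ℝ (Fin n) → ℝ := fun z => ∫ x, φ x z ∂π
    let εbar : EuclideanSpace ℝ (Fin n) → EuclideanSpace ℝ (Fin n) := fun z =>
      (1 / p z) • ∫ x, φ x z • ((Real.sqrt (1 - a))⁻¹ • (z - Real.sqrt a • x)) ∂π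
    (∀ z, 0 < p z) ∧
    Differentiable ℝ p ∧
    (∀ z, Integrable (fun x => φ x z) π) ∧
    (∀ z : EuclideanSpace ℝ (Fin n),
      Integrable (fun x => φ x z • ((Real.sqrt (1 - a))⁻¹ • (z - Real.sqrt a • x))) π) ∧
    (∀ z : EuclideanSpace ℝ (Fin n),
      gradient (fun z' => Real.log (p z')) z = (-(Real.sqrt (1 - a))⁻¹) • εbar z) := by
  intro φ p εbar
  have hv : 0 < 1 - a := by linarith
  have hc : 0 < (2 * Real.pi * (1 - a)) ^ (-(n : ℝ) / 2) := by
    have := Real.pi_pos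
    positivity
  have H := aux_main _ (1 - a) (Real.sqrt a) hv hc π
  have hp : ∀ z, 0 < p z := fun z => (H z).2.2.1
  refine ⟨hp, fun z => (H z).2.2.2.differentiableAt, fun z => (H z).1, fun z => ?_, fun z => ?_⟩
  · have := (H z).2.1.smul (Real.sqrt (1 - a))⁻¹
    refine this.congr (Filter.Eventually.of_forall fun x => ?_)
    exact smul_comm (Real.sqrt (1 - a))⁻¹ (φ x z) (z - Real.sqrt a • x)
  · apply HasGradientAt.gradient
    have h := (H z).2.2.2
    rw [hasGradientAt_iff_hasFDerivAt] at h ⊢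
    have h2 := HasFDerivAt.log h (hp z).ne'
    refine h2.congr_fderiv ?_
    have e : εbar z = (Real.sqrt (1 - a))⁻¹ • (p z)⁻¹ • ∫ x, φ x z • (z - Real.sqrt a • x) ∂π := by
      simp only [εbar]
      have h3 : ∀ x, φ x z • (Real.sqrt (1 - a))⁻¹ • (z - Real.sqrt a • x) =
          (Real.sqrt (1 - a))⁻¹ • φ x z • (z - Real.sqrt a • x) := fun x => smul_comm _ _ _
      simp only [h3]
      rw [one_div, integral_smul, smul_comm]
    have hs : (1 - a)⁻¹ = (Real.sqrt (1 - a))⁻¹ * (Real.sqrt (1 - a))⁻¹ := by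
      rw [← mul_inv, Real.mul_self_sqrt hv.le]
    rw [e]
    ext w
    simp only [smul_apply, InnerProductSpace.toDual_apply_apply,
      real_inner_smul_left, smul_eq_mul, hs]
    simp only [p, φ]
    ring
end

section
/- Let Y be a finite nonempty set, let w : Y → ℝ satisfy w(y) ≥ 0 for every y and Σ_{y∈Y} w(y) = 1, let (π_y)_{y∈Y} be probability measures on ℝⁿ, and let ᾱ ∈ (0,1). Define the conditional diffused densities p(z|y) = ∫ φ_{√ᾱ·x, 1−ᾱ}(z) dπ_y(x), the marginal p(z) = Σ_{y∈Y} w(y)·p(z|y), the posterior P(y|z) = w(y)·p(z|y)/p(z), and the marginal posterior-mean noise ε̄(z) = (1/p(z)) • ∫ φ_{√ᾱ·x, 1−ᾱ}(z) • ((z − √ᾱ·x)/√(1−ᾱ)) d(Σ_{y∈Y} w(y)·π_y)(x). Then each p(·|y) is everywhere positive and differentiable, and for every z ∈ ℝⁿ: − (1/√(1−ᾱ)) • ε̄(z) = Σ_{y∈Y} P(y|z) • ∇ log p(z|y). -/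
open MeasureTheory
open scoped BigOperators

theorem gaux_bound (v t : ℝ) (hv : 0 < v) :
    Real.exp (-t ^ 2 / (2 * v)) * t ≤ 1 + 2 * v := by
  have h1 : t ^ 2 / (2 * v) + 1 ≤ Real.exp (t ^ 2 / (2 * v)) := Real.add_one_le_exp _
  have h2 : Real.exp (-t ^ 2 / (2 * v)) = (Real.exp (t ^ 2 / (2 * v)))⁻¹ := by
    rw [← Real.exp_neg, neg_div]
  rw [h2, inv_mul_le_iff₀ (Real.exp_pos _)]
  have h3 : (t ^ 2 / (2 * v) + 1) * (1 + 2 * v) = t ^ 2 / (2 * v) + t ^ 2 + 1 + 2 * v := by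
    field_simp
    ring
  have h4 : 0 ≤ t ^ 2 / (2 * v) := by positivity
  have h5 := mul_le_mul_of_nonneg_right h1 (by positivity : 0 ≤ 1 + 2 * v)
  nlinarith [sq_nonneg (t - 1)]

theorem gaux_integrable {n : ℕ} (μ : Measure (EuclideanSpace ℝ (Fin n))) [IsFiniteMeasure μ]
    (C s v : ℝ) (hv : 0 < v) (z : EuclideanSpace ℝ (Fin n)) :
    Integrable (fun x => C * Real.exp (-‖z - s • x‖ ^ 2 / (2 * v))) μ := by
  refine Integrable.of_bound (C := |C|) ?_ (.of_forall fun x => ?_)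
  · exact (by fun_prop : Continuous fun x : EuclideanSpace ℝ (Fin n) =>
      C * Real.exp (-‖z - s • x‖ ^ 2 / (2 * v))).aestronglyMeasurable
  · rw [norm_mul, Real.norm_eq_abs, Real.norm_eq_abs, Real.abs_exp]
    refine mul_le_of_le_one_right (abs_nonneg _) (Real.exp_le_one_iff.2 ?_)
    rw [neg_div]
    have : 0 ≤ ‖z - s • x‖ ^ 2 / (2 * v) := by positivity
    linarith

theorem gaux_norm {n : ℕ} (C s v : ℝ) (hv : 0 < v) (z x : EuclideanSpace ℝ (Fin n)) :
    ‖(C * Real.exp (-‖z - s • x‖ ^ 2 / (2 * v))) • (z - s • x)‖ ≤ |C| * (1 + 2 * v) := by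
  rw [norm_smul, norm_mul, Real.norm_eq_abs, Real.norm_eq_abs, Real.abs_exp, mul_assoc]
  exact mul_le_mul_of_nonneg_left (gaux_bound v _ hv) (abs_nonneg _)

theorem gaux_integrable_vec {n : ℕ} (μ : Measure (EuclideanSpace ℝ (Fin n))) [IsFiniteMeasure μ]
    (C s v : ℝ) (hv : 0 < v) (z : EuclideanSpace ℝ (Fin n)) :
    Integrable (fun x => (C * Real.exp (-‖z - s • x‖ ^ 2 / (2 * v))) • (z - s • x)) μ := by
  refine Integrable.of_bound (C := |C| * (1 + 2 * v)) ?_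
    (.of_forall fun x => gaux_norm C s v hv z x)
  exact (by fun_prop : Continuous fun x : EuclideanSpace ℝ (Fin n) =>
      (C * Real.exp (-‖z - s • x‖ ^ 2 / (2 * v))) • (z - s • x)).aestronglyMeasurable

theorem gaux_fderiv {n : ℕ} (C s v : ℝ) (hv : 0 < v) (z x : EuclideanSpace ℝ (Fin n)) :
    HasFDerivAt (fun z => C * Real.exp (-‖z - s • x‖ ^ 2 / (2 * v)))
      (innerSL ℝ ((-v⁻¹) • ((C * Real.exp (-‖z - s • x‖ ^ 2 / (2 * v))) • (z - s • x)))) z := by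
  have h1 : HasFDerivAt (fun z : EuclideanSpace ℝ (Fin n) => z - s • x)
      (ContinuousLinearMap.id ℝ _) z := (hasFDerivAt_id z).sub_const _
  have h2 := (((h1.norm_sq).neg.mul_const (2 * v)⁻¹).exp).const_mul C
  simp only [← div_eq_mul_inv] at h2
  refine h2.congr_fderiv ?_
  ext u
  simp
  field_simp

theorem gaux_gradient {n : ℕ} (μ : Measure (EuclideanSpace ℝ (Fin n))) [IsFiniteMeasure μ]
    (C s v : ℝ) (hv : 0 < v) (z : EuclideanSpace ℝ (Fin n)) :
    HasFDerivAt (fun z => ∫ x, C * Real.exp (-‖z - s • x‖ ^ 2 / (2 * v)) ∂μ)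
      (innerSL ℝ ((-v⁻¹) • ∫ x, (C * Real.exp (-‖z - s • x‖ ^ 2 / (2 * v))) • (z - s • x) ∂μ))
      z := by
  have hint := (gaux_integrable_vec μ C s v hv z).smul (-v⁻¹)
  have key := hasFDerivAt_integral_of_dominated_of_fderiv_le (𝕜 := ℝ) (μ := μ)
    (F := fun z x => C * Real.exp (-‖z - s • x‖ ^ 2 / (2 * v)))
    (F' := fun z x => innerSL ℝ
      ((-v⁻¹) • ((C * Real.exp (-‖z - s • x‖ ^ 2 / (2 * v))) • (z - s • x))))
    (x₀ := z) (s := Set.univ) (bound := fun _ => v⁻¹ * (|C| * (1 + 2 * v))) Filter.univ_mem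
    (.of_forall fun z => (gaux_integrable μ C s v hv z).aestronglyMeasurable)
    (gaux_integrable μ C s v hv z)
    ((innerSL ℝ).continuous.comp_aestronglyMeasurable hint.aestronglyMeasurable)
    (.of_forall fun x z _ => by
      rw [innerSL_apply_norm, norm_smul, norm_neg, Real.norm_of_nonneg (inv_nonneg.2 hv.le)]
      exact mul_le_mul_of_nonneg_left (gaux_norm C s v hv z x) (inv_nonneg.2 hv.le))
    (integrable_const _)
    (.of_forall fun x z _ => gaux_fderiv C s v hv z x)
  refine key.congr_fderiv ?_
  rw [← integral_smul]
  exact (innerSL ℝ).integral_comp_comm hint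

/-- The rescaled marginal posterior-mean noise equals the posterior-weighted
average of the class-conditional scores. -/
theorem neg_posterior_mean_noise_eq_weighted_scores
    {n : ℕ} {Y : Type*} [Fintype Y] [Nonempty Y]
    (w : Y → ℝ) (hw0 : ∀ y, 0 ≤ w y) (hw1 : ∑ y, w y = 1)
    (π : Y → Measure (EuclideanSpace ℝ (Fin n))) [∀ y, IsProbabilityMeasure (π y)]
    (a : ℝ) (ha0 : 0 < a) (ha1 : a < 1) :
    let φ : EuclideanSpace ℝ (Fin n) → EuclideanSpace ℝ (Fin n) → ℝ := fun x z =>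
      (2 * Real.pi * (1 - a)) ^ (-(n : ℝ) / 2) *
        Real.exp (-‖z - Real.sqrt a • x‖ ^ 2 / (2 * (1 - a)))
    let pc : Y → EuclideanSpace ℝ (Fin n) → ℝ := fun y z => ∫ x, φ x z ∂(π y)
    let p : EuclideanSpace ℝ (Fin n) → ℝ := fun z => ∑ y, w y * pc y z
    let post : Y → EuclideanSpace ℝ (Fin n) → ℝ := fun y z => w y * pc y z / p z
    let mix : Measure (EuclideanSpace ℝ (Fin n)) := ∑ y, ENNReal.ofReal (w y) • π y
    let εbar : EuclideanSpace ℝ (Fin n) → EuclideanSpace ℝ (Fin n) := fun z =>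
      (1 / p z) •
        ∫ x, φ x z • ((Real.sqrt (1 - a))⁻¹ • (z - Real.sqrt a • x)) ∂mix
    (∀ y, ∀ z, 0 < pc y z) ∧
    (∀ y, Differentiable ℝ (pc y)) ∧
    (∀ z : EuclideanSpace ℝ (Fin n),
      (-(Real.sqrt (1 - a))⁻¹) • εbar z
        = ∑ y, post y z • gradient (fun z' => Real.log (pc y z')) z) := by
  intro φ pc p post mix εbar
  have hv : 0 < 1 - a := by linarith
  have hC : 0 < (2 * Real.pi * (1 - a)) ^ (-(n : ℝ) / 2) :=
    Real.rpow_pos_of_pos (by have := Real.pi_pos; positivity) _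
  have hpos : ∀ y, ∀ z, 0 < pc y z := by
    intro y z
    refine (integral_pos_iff_support_of_nonneg (fun x => ?_)
      (gaux_integrable (π y) _ _ _ hv z)).2 ?_
    · exact mul_nonneg hC.le (Real.exp_pos _).le
    · have : (Function.support fun x => φ x z) = Set.univ := by
        ext x
        exact iff_of_true (mul_pos hC (Real.exp_pos _)).ne' trivial
      change 0 < (π y) (Function.support fun x => φ x z)
      rw [this, measure_univ]
      exact one_pos
  have hgrad := fun y z => gaux_gradient (π y) ((2 * Real.pi * (1 - a)) ^ (-(n : ℝ) / 2))
    (Real.sqrt a) (1 - a) hv z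
  refine ⟨hpos, fun y z => (hgrad y z).differentiableAt, fun z => ?_⟩
  have hlog : ∀ y, gradient (fun z' => Real.log (pc y z')) z =
      (pc y z)⁻¹ • ((-(1 - a)⁻¹) • ∫ x, φ x z • (z - Real.sqrt a • x) ∂(π y)) := by
    intro y
    apply HasGradientAt.gradient
    rw [hasGradientAt_iff_hasFDerivAt]
    refine (HasFDerivAt.log (hgrad y z) (hpos y z).ne').congr_fderiv ?_
    ext u
    rw [InnerProductSpace.toDual_apply_apply, real_inner_smul_left]
    rfl
  have hmix : ∫ x, φ x z • ((Real.sqrt (1 - a))⁻¹ • (z - Real.sqrt a • x)) ∂mix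
      = (Real.sqrt (1 - a))⁻¹ • ∑ y, w y • ∫ x, φ x z • (z - Real.sqrt a • x) ∂(π y) := by
    simp_rw [smul_comm (φ _ z) (Real.sqrt (1 - a))⁻¹]
    rw [integral_smul]
    congr 1
    rw [integral_finsetSum_measure]
    · refine Finset.sum_congr rfl fun y _ => ?_
      rw [integral_smul_measure, ENNReal.toReal_ofReal (hw0 y)]
    · intro y _
      exact (gaux_integrable_vec (π y) _ _ _ hv z).smul_measure ENNReal.ofReal_ne_top
  have hs : (Real.sqrt (1 - a))⁻¹ * (Real.sqrt (1 - a))⁻¹ = (1 - a)⁻¹ := by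
    rw [← mul_inv, Real.mul_self_sqrt hv.le]
  simp only [εbar, hmix, hlog, post]
  simp only [Finset.smul_sum, smul_smul]
  refine Finset.sum_congr rfl fun y _ => ?_
  congr 1
  have := (hpos y z).ne'
  rw [← hs]
  generalize (Real.sqrt (1 - a))⁻¹ = r
  field_simp
end
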